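/- arXiv:1806.06756 — 2 statements merged into one kernel-verified Lean document; each statement's English description precedes it below -/
import Mathlib

section
/- Let ε > 0 and let w̄, m ∈ ℝ satisfy ε ≤ w̄ and m < w̄. Define θ = min{1, (w̄ − ε)/(w̄ − m)}. Then 0 ≤ θ ≤ 1, and for every a ∈ ℝ with m ≤ a, the damped value (1 − θ)·w̄ + θ·a satisfies (1 − θ)·w̄ + θ·a ≥ ε. -/
/-- Correctness of the Zhang–Shu-style positivity limiter for a single variable: if the cell
average `wbar` satisfies `ε ≤ wbar` and the pointwise minimum `m` satisfies `m < wbar`, then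
the damping parameter `θ = min{1, (wbar − ε)/(wbar − m)}` lies in `[0,1]` and every damped
value `(1 − θ)·wbar + θ·a` with `a ≥ m` stays above the tolerance `ε`. -/
theorem zhang_shu_limiter_positivity
    (ε wbar m : ℝ) (hε : 0 < ε) (hw : ε ≤ wbar) (hm : m < wbar) :
    let θ := min 1 ((wbar - ε) / (wbar - m))
    0 ≤ θ ∧ θ ≤ 1 ∧ ∀ a : ℝ, m ≤ a → ε ≤ (1 - θ) * wbar + θ * a := by
  intro θ
  have hd : 0 < wbar - m := sub_pos.mpr hm
  have h0 : 0 ≤ θ := le_min zero_le_one (div_nonneg (sub_nonneg.mpr hw) hd.le)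
  have h1 : θ ≤ 1 := min_le_left _ _
  have h2 : θ * (wbar - m) ≤ wbar - ε := (le_div_iff₀ hd).mp (min_le_right _ _)
  refine ⟨h0, h1, fun a ha => ?_⟩
  have h3 : θ * m ≤ θ * a := mul_le_mul_of_nonneg_left ha h0
  linarith
end

section
/- Let γ > 1, let ε > 0, let q̄ ∈ ℝ³ with q̄₁ > 0, and let q₁, …, q_N ∈ ℝ³ (N ≥ 1) each with positive first component. Let p(ρ, m, E) = (γ−1)(E − m²/(2ρ)), set p̄ = p(q̄) and p_min = min_{1 ≤ i ≤ N} p(q_i), and assume ε ≤ p̄ and p_min < p̄. Define θ = min{1, (p̄ − ε)/(p̄ − p_min)}. Then 0 ≤ θ ≤ 1, and for every i, p((1 − θ)·q̄ + θ·q_i) ≥ ε; that is, the near-optimal damping parameter obtained by linearizing via concavity of the pressure makes the limited solution satisfy the pressure positivity constraint at all positivity points. -/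
/-- Tangent-line bound for the kinetic energy. -/
lemma kin_tangent (v m r : ℝ) (hr : 0 < r) : v * m - v ^ 2 * r / 2 ≤ m ^ 2 / (2 * r) := by
  rw [le_div_iff₀ (by positivity)]
  nlinarith [sq_nonneg (m - v * r)]

/-- Joint convexity of the kinetic energy. -/
lemma kin_convex (t m n r s : ℝ) (h0 : 0 ≤ t) (h1 : t ≤ 1) (hr : 0 < r) (hs : 0 < s) :
    ((1 - t) * m + t * n) ^ 2 / (2 * ((1 - t) * r + t * s)) ≤
      (1 - t) * (m ^ 2 / (2 * r)) + t * (n ^ 2 / (2 * s)) := by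
  have hR : 0 < (1 - t) * r + t * s := by
    rcases h0.eq_or_lt with h | h
    · subst h; simpa using hr
    · have := mul_pos h hs
      have := mul_nonneg (sub_nonneg.2 h1) hr.le
      linarith
  set R := (1 - t) * r + t * s with hRd
  set M := (1 - t) * m + t * n with hMd
  have e : M ^ 2 / (2 * R) = (M / R) * M - (M / R) ^ 2 * R / 2 := by
    field_simp
    ring
  have a := mul_le_mul_of_nonneg_left (kin_tangent (M / R) m r hr) (sub_nonneg.2 h1)
  have b := mul_le_mul_of_nonneg_left (kin_tangent (M / R) n s hs) h0
  rw [e]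
  generalize M / R = v at *
  rw [hRd, hMd]
  linarith

/-- Correctness of the near-optimal pressure positivity limiter for the compressible Euler
equations: with `pbar = p(qbar)`, `pmin = min_i p(q i)`, `ε ≤ pbar` and `pmin < pbar`, the
damping parameter `θ = min{1, (pbar − ε)/(pbar − pmin)}` lies in `[0,1]` and the limited
states `(1−θ)·qbar + θ·q i` satisfy the pressure positivity constraint `p ≥ ε` at every
positivity point. -/
theorem euler_pressure_limiter_positivity
    (γ : ℝ) (hγ : 1 < γ) (ε : ℝ) (hε : 0 < ε)
    (N : ℕ) (hN : 1 ≤ N)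
    (qbar : ℝ × ℝ × ℝ) (hqbar : 0 < qbar.1)
    (q : Fin N → ℝ × ℝ × ℝ) (hq : ∀ i, 0 < (q i).1) :
    let pr : ℝ × ℝ × ℝ → ℝ :=
      fun s => (γ - 1) * (s.2.2 - s.2.1 ^ 2 / (2 * s.1))
    let pbar := pr qbar
    let pmin := ⨅ i : Fin N, pr (q i)
    ε ≤ pbar → pmin < pbar →
      let θ := min 1 ((pbar - ε) / (pbar - pmin))
      0 ≤ θ ∧ θ ≤ 1 ∧ ∀ i : Fin N, ε ≤ pr ((1 - θ) • qbar + θ • q i) := by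
  intro pr pbar pmin h1 h2 θ
  have hd : 0 < pbar - pmin := sub_pos.2 h2
  have t0 : 0 ≤ θ := le_min zero_le_one (div_nonneg (sub_nonneg.2 h1) hd.le)
  have t1 : θ ≤ 1 := min_le_left _ _
  refine ⟨t0, t1, fun i => ?_⟩
  have hm : pmin ≤ pr (q i) := ciInf_le (Set.finite_range _).bddBelow i
  have ht : θ * (pbar - pmin) ≤ pbar - ε := (le_div_iff₀ hd).1 (min_le_right _ _)
  have hc : (1 - θ) * pbar + θ * pr (q i) ≤ pr ((1 - θ) • qbar + θ • q i) := by
    have k := mul_le_mul_of_nonneg_left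
      (kin_convex θ qbar.2.1 (q i).2.1 qbar.1 (q i).1 t0 t1 hqbar (hq i)) (sub_pos.2 hγ).le
    simp only [pbar, pr, Prod.fst_add, Prod.snd_add, Prod.smul_fst, Prod.smul_snd, smul_eq_mul]
    linarith
  have := mul_le_mul_of_nonneg_left hm t0
  linarith
end
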